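/- (Estimate (4.finish) from the proof of Proposition 4.8, commutative kernel version.) In the Markov kernel semigroup setup, for every bounded measurable f : Ω → ℝ and every t > 0: sup_{x∈Ω} T_t((f − T_{4t} f)²)(x) ≤ 9·‖f‖_{BMO_c^*(T)}². -/

import Mathlib

open MeasureTheory ProbabilityTheory

/-- `T_t f(x) = ∫ f dκ_t(x)` for a family of kernels. -/
noncomputable def Tker {Ω : Type*} [MeasurableSpace Ω] (κ : ℝ → Kernel Ω Ω)
    (t : ℝ) (f : Ω → ℝ) (x : Ω) : ℝ :=
  ∫ y, f y ∂(κ t x)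

/-- The BMO norm `‖f‖_{BMO_c^*(T)} = sup_{t>0} sup_x (T_t((f − T_t f)²)(x))^{1/2}`. -/
noncomputable def bmoCStar {Ω : Type*} [MeasurableSpace Ω] (κ : ℝ → Kernel Ω Ω)
    (f : Ω → ℝ) : ℝ :=
  ⨆ t : Set.Ioi (0 : ℝ), ⨆ x : Ω,
    Real.sqrt (Tker κ t (fun y => (f y - Tker κ t f y) ^ 2) x)

theorem abs_sq_le_sq_of_abs_le {α : Type*} {g : α → ℝ} {C : ℝ} (hC : ∀ x, |g x| ≤ C) (x : α) :
    |g x ^ 2| ≤ C ^ 2 := by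
  rw [abs_pow]
  exact pow_le_pow_left₀ (abs_nonneg _) (hC x) 2

section MarkovOperator

variable {Ω : Type*} [MeasurableSpace Ω] {κ : ℝ → Kernel Ω Ω} {f g : Ω → ℝ} {s C : ℝ}

theorem integrable_of_measurable_of_abs_le {μ : Measure Ω} [IsFiniteMeasure μ]
    (hg : Measurable g) (hC : ∀ x, |g x| ≤ C) : Integrable g μ :=
  Integrable.of_bound hg.aestronglyMeasurable C (Filter.Eventually.of_forall hC)

theorem measurable_Tker (hg : Measurable g) :
    Measurable (Tker κ s g) :=
  (hg.stronglyMeasurable.integral_kernel (κ := κ s)).measurable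

theorem abs_Tker_le (hs : IsMarkovKernel (κ s)) (hC : ∀ x, |g x| ≤ C) (x : Ω) :
    |Tker κ s g x| ≤ C := by
  have h := norm_integral_le_of_norm_le_const (μ := κ s x) (f := g) (C := C)
    (Filter.Eventually.of_forall hC)
  simpa [Tker] using h

theorem Tker_sub (hs : IsMarkovKernel (κ s)) {C' : ℝ} (hf : Measurable f)
    (hfC : ∀ x, |f x| ≤ C) (hg : Measurable g) (hgC : ∀ x, |g x| ≤ C') (x : Ω) :
    Tker κ s (fun y => f y - g y) x = Tker κ s f x - Tker κ s g x :=
  integral_sub (integrable_of_measurable_of_abs_le hf hfC)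
    (integrable_of_measurable_of_abs_le hg hgC)

/-- Jensen's inequality for the square. -/
theorem sq_Tker_le (hs : IsMarkovKernel (κ s)) (hg : Measurable g) (hC : ∀ x, |g x| ≤ C)
    (x : Ω) : Tker κ s g x ^ 2 ≤ Tker κ s (fun y => g y ^ 2) x := by
  have hi : Integrable g (κ s x) := integrable_of_measurable_of_abs_le hg hC
  have hi2 : Integrable (fun y => g y ^ 2) (κ s x) :=
    integrable_of_measurable_of_abs_le (hg.pow_const 2) (abs_sq_le_sq_of_abs_le hC)
  set c := Tker κ s g x with hc
  have h : ∫ y, (2 * c * g y - c ^ 2) ∂(κ s x) ≤ ∫ y, g y ^ 2 ∂(κ s x) :=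
    integral_mono ((hi.const_mul _).sub (integrable_const _)) hi2
      fun y => by nlinarith [sq_nonneg (g y - c)]
  rw [integral_sub (hi.const_mul _) (integrable_const _), integral_const_mul] at h
  have hcc : ∫ y, g y ∂(κ s x) = c := rfl
  simp only [hcc, integral_const, probReal_univ, one_smul] at h
  change c ^ 2 ≤ ∫ y, g y ^ 2 ∂(κ s x)
  linarith

theorem abs_sub_Tker_le (hs : IsMarkovKernel (κ s)) (hC : ∀ x, |f x| ≤ C) (y : Ω) :
    |f y - Tker κ s f y| ≤ 2 * C := by
  linarith [abs_sub (f y) (Tker κ s f y), hC y, abs_Tker_le hs hC y]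

theorem Tker_sq_sub_le (hmk : ∀ t : ℝ, 0 < t → IsMarkovKernel (κ t))
    (hC : ∀ x, |f x| ≤ C) (hs : 0 < s) (x : Ω) :
    Tker κ s (fun y => (f y - Tker κ s f y) ^ 2) x ≤ bmoCStar κ f ^ 2 := by
  have hC0 : 0 ≤ C := (abs_nonneg _).trans (hC x)
  have hb (r : Set.Ioi (0 : ℝ)) (z : Ω) :
      √(Tker κ r (fun y => (f y - Tker κ r f y) ^ 2) z) ≤ 2 * C := by
    refine Real.sqrt_le_iff.2 ⟨by positivity, ?_⟩
    exact (le_abs_self _).trans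
      (abs_Tker_le (hmk r r.2) (abs_sq_le_sq_of_abs_le (abs_sub_Tker_le (hmk r r.2) hC)) z)
  have hle : √(Tker κ s (fun y => (f y - Tker κ s f y) ^ 2) x) ≤ bmoCStar κ f :=
    le_ciSup_of_le (f := fun r : Set.Ioi (0 : ℝ) => ⨆ z : Ω,
        √(Tker κ r (fun y => (f y - Tker κ r f y) ^ 2) z))
      ⟨2 * C, by rintro _ ⟨r, rfl⟩; exact Real.iSup_le (hb r) (by positivity)⟩ ⟨s, hs⟩
      (le_ciSup (f := fun z : Ω => √(Tker κ s (fun y => (f y - Tker κ s f y) ^ 2) z))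
        ⟨2 * C, by rintro _ ⟨z, rfl⟩; exact hb ⟨s, hs⟩ z⟩ x)
  exact (Real.sqrt_le_left ((Real.sqrt_nonneg _).trans hle)).1 hle

theorem abs_Tker_sub_Tker_double_le (hmk : ∀ t : ℝ, 0 < t → IsMarkovKernel (κ t))
    (hf : Measurable f) (hC : ∀ x, |f x| ≤ C) (hs : 0 < s)
    (hsg : Tker κ (s + s) f = Tker κ s (Tker κ s f)) (x : Ω) :
    |Tker κ s f x - Tker κ (2 * s) f x| ≤ |bmoCStar κ f| := by
  have hm := measurable_Tker (κ := κ) (s := s) hf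
  rw [two_mul, hsg, ← Tker_sub (hmk s hs) hf hC hm (abs_Tker_le (hmk s hs) hC)]
  exact sq_le_sq.1 ((sq_Tker_le (hmk s hs) (hf.sub hm)
    (abs_sub_Tker_le (hmk s hs) hC) x).trans (Tker_sq_sub_le hmk hC hs x))

end MarkovOperator

/-- Estimate (4.finish) from the proof of Proposition 4.8, commutative kernel version:
`sup_x T_t((f − T_{4t} f)²)(x) ≤ 9 ‖f‖_{BMO_c^*(T)}²`. -/
theorem finish_estimate_prop48 {Ω : Type*} [MeasurableSpace Ω]
    (κ : ℝ → Kernel Ω Ω)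
    (hmk : ∀ t : ℝ, 0 < t → IsMarkovKernel (κ t))
    (hsg : ∀ s t : ℝ, 0 < s → 0 < t → ∀ g : Ω → ℝ, Measurable g →
      (∃ C : ℝ, ∀ x, |g x| ≤ C) → Tker κ (s + t) g = Tker κ t (Tker κ s g))
    (f : Ω → ℝ) (hf : Measurable f) (hfb : ∃ C : ℝ, ∀ x, |f x| ≤ C)
    (t : ℝ) (ht : 0 < t) :
    (⨆ x : Ω, Tker κ t (fun y => (f y - Tker κ (4 * t) f y) ^ 2) x) ≤
      9 * (bmoCStar κ f) ^ 2 := by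
  refine Real.iSup_le (fun x => ?_) (by positivity)
  obtain ⟨C, hC⟩ := hfb
  have := hmk t ht
  have h4 := hmk (4 * t) (by positivity)
  set B := bmoCStar κ f
  have hg (y : Ω) : (Tker κ t f y - Tker κ (4 * t) f y) ^ 2 ≤ 4 * B ^ 2 := by
    have h1 := abs_Tker_sub_Tker_double_le hmk hf hC ht (hsg t t ht ht f hf ⟨C, hC⟩) y
    have h2t : 0 < 2 * t := by positivity
    have h2 := abs_Tker_sub_Tker_double_le hmk hf hC h2t (hsg _ _ h2t h2t f hf ⟨C, hC⟩) y
    rw [show 2 * (2 * t) = 4 * t by ring] at h2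
    have h3 := (abs_sub_le _ _ _).trans (add_le_add h1 h2)
    calc (Tker κ t f y - Tker κ (4 * t) f y) ^ 2
        = |Tker κ t f y - Tker κ (4 * t) f y| ^ 2 := (sq_abs _).symm
      _ ≤ (|B| + |B|) ^ 2 := pow_le_pow_left₀ (abs_nonneg _) h3 2
      _ = 4 * B ^ 2 := by rw [← sq_abs B]; ring
  have hi : Integrable (fun y => (f y - Tker κ t f y) ^ 2) (κ t x) :=
    integrable_of_measurable_of_abs_le ((hf.sub (measurable_Tker hf)).pow_const 2)
      (abs_sq_le_sq_of_abs_le (abs_sub_Tker_le this hC))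
  have hi4 : Integrable (fun y => (f y - Tker κ (4 * t) f y) ^ 2) (κ t x) :=
    integrable_of_measurable_of_abs_le ((hf.sub (measurable_Tker hf)).pow_const 2)
      (abs_sq_le_sq_of_abs_le (abs_sub_Tker_le h4 hC))
  -- `(a + b)² ≤ 3 a² + (3 / 2) b²` is the weighted Young inequality, sharp at `b = 2 a`.
  calc Tker κ t (fun y => (f y - Tker κ (4 * t) f y) ^ 2) x
      ≤ ∫ y, (3 * (f y - Tker κ t f y) ^ 2 + 6 * B ^ 2) ∂(κ t x) :=
        integral_mono hi4 ((hi.const_mul 3).add (integrable_const _)) fun y => by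
          nlinarith [hg y, sq_nonneg (2 * (f y - Tker κ t f y) -
            (Tker κ t f y - Tker κ (4 * t) f y))]
    _ = 3 * Tker κ t (fun y => (f y - Tker κ t f y) ^ 2) x + 6 * B ^ 2 := by
        rw [integral_add (hi.const_mul 3) (integrable_const _), integral_const_mul]
        simp [Tker]
    _ ≤ 9 * B ^ 2 := by linarith [Tker_sq_sub_le hmk hC ht x]
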